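/- Under the stated limit assumptions, one has 4√e/r_∞ = u_∞·(α − 2). -/

import Mathlib

open Real MeasureTheory Set Filter

noncomputable section

/-- The radial energy functional for the Lane–Emden problem on the unit ball of `ℝ²`
(written in polar coordinates; the common factor `2π` is dropped). -/
def radialEnergy (p : ℝ) (v : ℝ → ℝ) : ℝ :=
  (1 / 2) * (∫ r in (0:ℝ)..1, (deriv v r) ^ 2 * r)
    - (1 / (p + 1)) * ∫ r in (0:ℝ)..1, |v r| ^ (p + 1) * r

/-- The Nehari identity `∫_B |∇v⁺|² = ∫_B |v⁺|^{p+1}` for the positive part,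
written in polar coordinates. -/
def nehariPos (p : ℝ) (v : ℝ → ℝ) : Prop :=
  (∫ r in (0:ℝ)..1, (if 0 < v r then (deriv v r) ^ 2 * r else 0))
    = ∫ r in (0:ℝ)..1, (max (v r) 0) ^ (p + 1) * r

/-- The Nehari identity `∫_B |∇v⁻|² = ∫_B |v⁻|^{p+1}` for the negative part,
written in polar coordinates. -/
def nehariNeg (p : ℝ) (v : ℝ → ℝ) : Prop :=
  (∫ r in (0:ℝ)..1, (if v r < 0 then (deriv v r) ^ 2 * r else 0))
    = ∫ r in (0:ℝ)..1, (max (-v r) 0) ^ (p + 1) * r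

/-- A family `p ↦ u p` (for `p > 1`) of least energy nodal radial solutions of the
Lane–Emden problem `−Δu = |u|^{p−1}u` in the unit ball `B ⊆ ℝ²`, `u = 0` on `∂B`,
described through the radial profile `u p : ℝ → ℝ`.  `rp p ∈ (0,1)` is the nodal
radius, `sp p ∈ (rp p, 1)` is a radius where `u p` attains `‖(u p)⁺‖_∞`; the solution
is negative in the inner nodal region (`u p 0 < 0`), attains `-‖(u p)⁻‖_∞` at `0`,
and minimizes the energy among radial members of the nodal Nehari set. -/
structure LaneEmdenFamily where
  u : ℝ → ℝ → ℝ
  rp : ℝ → ℝ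
  sp : ℝ → ℝ
  smooth : ∀ p, 1 < p → ContDiffOn ℝ 2 (u p) (Icc (0:ℝ) 1)
  ode : ∀ p, 1 < p → ∀ r ∈ Ioo (0:ℝ) 1,
    -deriv (deriv (u p)) r - deriv (u p) r / r = |u p r| ^ (p - 1) * u p r
  derivAtZero : ∀ p, 1 < p → deriv (u p) 0 = 0
  boundary : ∀ p, 1 < p → u p 1 = 0
  center_neg : ∀ p, 1 < p → u p 0 < 0
  min_at_zero : ∀ p, 1 < p → ∀ r ∈ Icc (0:ℝ) 1, u p 0 ≤ u p r
  rp_mem : ∀ p, 1 < p → rp p ∈ Ioo (0:ℝ) 1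
  rp_zero : ∀ p, 1 < p → u p (rp p) = 0
  neg_in : ∀ p, 1 < p → ∀ r ∈ Ico (0:ℝ) (rp p), u p r < 0
  pos_out : ∀ p, 1 < p → ∀ r ∈ Ioo (rp p) 1, 0 < u p r
  sp_mem : ∀ p, 1 < p → sp p ∈ Ioo (rp p) 1
  sp_max : ∀ p, 1 < p → ∀ r ∈ Icc (0:ℝ) 1, u p r ≤ u p (sp p)
  least_energy : ∀ p, 1 < p → ∀ v : ℝ → ℝ,
    ContDiffOn ℝ 1 v (Icc (0:ℝ) 1) → v 1 = 0 →
    (∃ r ∈ Ioo (0:ℝ) 1, 0 < v r) → (∃ r ∈ Ioo (0:ℝ) 1, v r < 0) →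
    nehariPos p v → nehariNeg p v →
    radialEnergy p (u p) ≤ radialEnergy p v

/-- `ε_p⁺`, defined by `(ε_p⁺)⁻² = p · ‖u_p⁺‖_∞^{p−1} = p · u_p(s_p)^{p−1}`. -/
def epsP (F : LaneEmdenFamily) (p : ℝ) : ℝ :=
  1 / Real.sqrt (p * F.u p (F.sp p) ^ (p - 1))

/-- `ε_p⁻`, defined by `(ε_p⁻)⁻² = p · ‖u_p⁻‖_∞^{p−1} = p · |u_p(0)|^{p−1}`. -/
def epsM (F : LaneEmdenFamily) (p : ℝ) : ℝ :=
  1 / Real.sqrt (p * (-F.u p 0) ^ (p - 1))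

/-- `α = √(2l² + 4)`. -/
def alphaOf (l : ℝ) : ℝ := Real.sqrt (2 * l ^ 2 + 4)

/-- `β = ((α+2)/(α−2))^{1/α} · l`. -/
def betaOf (l : ℝ) : ℝ := ((alphaOf l + 2) / (alphaOf l - 2)) ^ (1 / alphaOf l) * l

/-- The singular Liouville profile `Z_l(r) = log(2α²β^α r^{α−2}/(β^α + r^α)²)`. -/
def Zl (l : ℝ) (r : ℝ) : ℝ :=
  Real.log (2 * alphaOf l ^ 2 * betaOf l ^ alphaOf l * r ^ (alphaOf l - 2)
    / (betaOf l ^ alphaOf l + r ^ alphaOf l) ^ 2)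

/-- A function with nonnegative derivative on a convex set is monotone there. -/
lemma monotoneOn_of_hasDerivAt_nonneg {D : Set ℝ} (hD : Convex ℝ D) {f f' : ℝ → ℝ}
    (hf : ∀ t ∈ D, HasDerivAt f (f' t) t) (hf' : ∀ t ∈ D, 0 ≤ f' t) : MonotoneOn f D :=
  monotoneOn_of_deriv_nonneg hD (fun t ht => (hf t ht).continuousAt.continuousWithinAt)
    (fun t ht => (hf t (interior_subset ht)).differentiableAt.differentiableWithinAt)
    (fun t ht => by
      rw [(hf t (interior_subset ht)).deriv]
      exact hf' t (interior_subset ht))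

/-- A function with nonnegative derivative on `(-∞, T]` is bounded below by its limit at `-∞`. -/
lemma le_of_tendsto_atBot_of_hasDerivAt_nonneg {T c : ℝ} {f f' : ℝ → ℝ}
    (hf : ∀ t ≤ T, HasDerivAt f (f' t) t) (hf' : ∀ t ≤ T, 0 ≤ f' t)
    (hc : Tendsto f atBot (nhds c)) {t : ℝ} (ht : t ≤ T) : c ≤ f t := by
  have hm := monotoneOn_of_hasDerivAt_nonneg (convex_Iic T) hf hf'
  refine le_of_tendsto hc ?_
  filter_upwards [eventually_le_atBot t] with s hs
  exact hm (hs.trans ht) ht hs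

lemma tendsto_exp_two_mul_atBot :
    Tendsto (fun t : ℝ => Real.exp (2 * t)) atBot (nhds 0) :=
  Real.tendsto_exp_atBot.comp (tendsto_id.const_mul_atBot two_pos)

lemma hasDerivAt_exp_two_mul (t : ℝ) :
    HasDerivAt (fun s : ℝ => Real.exp (2 * s)) (2 * Real.exp (2 * t)) t := by
  have h := ((hasDerivAt_id t).const_mul 2).exp
  simpa [mul_comm] using h

lemma hasDerivAt_exp_two_mul_mul_rpow {p t v' : ℝ} (hp : 1 < p) {v : ℝ → ℝ}
    (hv : HasDerivAt v v' t) :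
    HasDerivAt (fun s => Real.exp (2 * s) * v s ^ (p + 1))
      (2 * Real.exp (2 * t) * v t ^ (p + 1)
        + Real.exp (2 * t) * (v' * (p + 1) * v t ^ p)) t := by
  have h := hv.rpow_const (p := p + 1) (Or.inr (by linarith))
  rw [add_sub_cancel_right] at h
  exact (hasDerivAt_exp_two_mul t).mul h

/-- A rescaled positive radial Lane–Emden solution on a disk in the logarithmic variable `t`:
`v` solves `v'' = -e^{2t} v^p / p`, takes the value `1` at the centre `t = -∞` and vanishes at
`t = T`; the function `y` is `-p v'`. -/
structure IsDiskProfile (p T : ℝ) (v y : ℝ → ℝ) : Prop where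
  deriv_v : ∀ t ≤ T, HasDerivAt v (-(y t / p)) t
  deriv_y : ∀ t ≤ T, HasDerivAt y (Real.exp (2 * t) * v t ^ p) t
  nonneg : ∀ t ≤ T, 0 ≤ v t
  le_one : ∀ t ≤ T, v t ≤ 1
  tendsto_v : Tendsto v atBot (nhds 1)
  tendsto_y : Tendsto y atBot (nhds 0)
  v_end : v T = 0

namespace IsDiskProfile

variable {p T : ℝ} {v y : ℝ → ℝ}

lemma y_mono (h : IsDiskProfile p T v y) : MonotoneOn y (Iic T) :=
  monotoneOn_of_hasDerivAt_nonneg (convex_Iic T) h.deriv_y fun t ht =>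
    mul_nonneg (Real.exp_pos _).le (Real.rpow_nonneg (h.nonneg t ht) _)

lemma y_nonneg (h : IsDiskProfile p T v y) {t : ℝ} (ht : t ≤ T) : 0 ≤ y t :=
  le_of_tendsto_atBot_of_hasDerivAt_nonneg h.deriv_y (fun t ht =>
    mul_nonneg (Real.exp_pos _).le (Real.rpow_nonneg (h.nonneg t ht) _)) h.tendsto_y ht

lemma y_le (h : IsDiskProfile p T v y) (hp : 1 < p) {t : ℝ} (ht : t ≤ T) :
    y t ≤ Real.exp (2 * t) / 2 := by
  have key := le_of_tendsto_atBot_of_hasDerivAt_nonneg (c := 0)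
    (f := fun t => Real.exp (2 * t) / 2 - y t)
    (fun t ht => ((hasDerivAt_exp_two_mul t).div_const 2).sub (h.deriv_y t ht))
    (fun t ht => by
      have := Real.rpow_le_one (h.nonneg t ht) (h.le_one t ht) (by linarith : 0 ≤ p)
      nlinarith [Real.exp_pos (2 * t)])
    (by simpa using (tendsto_exp_two_mul_atBot.div_const 2).sub h.tendsto_y) ht
  linarith

lemma le_v (h : IsDiskProfile p T v y) (hp : 1 < p) {t : ℝ} (ht : t ≤ T) :
    1 - Real.exp (2 * t) / (4 * p) ≤ v t := by
  have key := le_of_tendsto_atBot_of_hasDerivAt_nonneg (c := 1)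
    (f := fun t => v t + Real.exp (2 * t) / (4 * p))
    (fun t ht => (h.deriv_v t ht).add ((hasDerivAt_exp_two_mul t).div_const (4 * p)))
    (fun t ht => by
      have := h.y_le hp ht
      have e : -(y t / p) + 2 * Real.exp (2 * t) / (4 * p)
        = (Real.exp (2 * t) / 2 - y t) / p := by
        field_simp; ring
      rw [e]
      exact div_nonneg (by linarith) (by linarith))
    (by simpa using h.tendsto_v.add (tendsto_exp_two_mul_atBot.div_const (4 * p))) ht
  linarith

lemma tendsto_exp_mul_rpow (h : IsDiskProfile p T v y) (hp : 1 < p) :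
    Tendsto (fun t => Real.exp (2 * t) * v t ^ (p + 1)) atBot (nhds 0) := by
  refine tendsto_of_tendsto_of_tendsto_of_le_of_le' tendsto_const_nhds
    tendsto_exp_two_mul_atBot ?_ ?_
  · filter_upwards [eventually_le_atBot T] with t ht
    exact mul_nonneg (Real.exp_pos _).le (Real.rpow_nonneg (h.nonneg t ht) _)
  · filter_upwards [eventually_le_atBot T] with t ht
    exact mul_le_of_le_one_right (Real.exp_pos _).le
      (Real.rpow_le_one (h.nonneg t ht) (h.le_one t ht) (by linarith))

lemma hasDerivAt_energy (h : IsDiskProfile p T v y) (hp : 1 < p) {t : ℝ} (ht : t ≤ T) :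
    HasDerivAt (fun t => (1 + 1 / p) * y t ^ 2 / 2 - 2 * y t + Real.exp (2 * t) * v t ^ (p + 1))
      (-(2 * (Real.exp (2 * t) * v t ^ p) * (1 - v t))) t := by
  have hy := h.deriv_y t ht
  have h1 := ((((hy.pow 2).const_mul (1 + 1 / p)).div_const 2).sub (hy.const_mul 2)).add
    (hasDerivAt_exp_two_mul_mul_rpow hp (h.deriv_v t ht))
  refine h1.congr_deriv ?_
  have : v t ^ (p + 1) = v t ^ p * v t := Real.rpow_add_one' (h.nonneg t ht) (by linarith)
  rw [this]
  have : p ≠ 0 := by linarith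
  simp only [Nat.cast_ofNat]
  field_simp
  ring

lemma tendsto_energy (h : IsDiskProfile p T v y) (hp : 1 < p) :
    Tendsto (fun t => (1 + 1 / p) * y t ^ 2 / 2 - 2 * y t + Real.exp (2 * t) * v t ^ (p + 1))
      atBot (nhds 0) := by
  have h1 := ((((h.tendsto_y.pow 2).const_mul (1 + 1 / p)).div_const 2).sub
    (h.tendsto_y.const_mul 2)).add (h.tendsto_exp_mul_rpow hp)
  simpa using h1

lemma y_le_four (h : IsDiskProfile p T v y) (hp : 1 < p) {t : ℝ} (ht : t ≤ T) : y t ≤ 4 := by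
  have key := le_of_tendsto_atBot_of_hasDerivAt_nonneg
    (fun t ht => (h.hasDerivAt_energy hp ht).neg)
    (fun t ht => by
      have h1 := Real.rpow_nonneg (h.nonneg t ht) p
      have h2 := h.le_one t ht
      rw [neg_neg]
      exact mul_nonneg (by positivity) (by linarith))
    (neg_zero (G := ℝ) ▸ (h.tendsto_energy hp).neg) ht
  have h0 : 0 ≤ Real.exp (2 * t) * v t ^ (p + 1) :=
    mul_nonneg (Real.exp_pos _).le (Real.rpow_nonneg (h.nonneg t ht) _)
  have h1 := h.y_nonneg ht
  have h2 : 0 ≤ 1 / p * y t ^ 2 := by positivity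
  simp only [Pi.neg_apply] at key
  by_contra! hc
  nlinarith

lemma exp_mul_rpow_ge (h : IsDiskProfile p T v y) (hp : 1 < p) {t : ℝ} (ht : t ≤ T) :
    y t * (2 * v t - (1 + 1 / p) * y t / 2) ≤ Real.exp (2 * t) * v t ^ p := by
  have key := le_of_tendsto_atBot_of_hasDerivAt_nonneg
    (fun t ht => (h.hasDerivAt_energy hp ht).add
      ((((h.deriv_v t ht).const_sub 1).mul (h.deriv_y t ht)).const_mul 2))
    (fun t ht => by
      have e : -(2 * (Real.exp (2 * t) * v t ^ p) * (1 - v t))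
        + 2 * (-(-(y t / p)) * y t + (1 - v t) * (Real.exp (2 * t) * v t ^ p))
        = 2 * y t ^ 2 / p := by ring
      rw [e]
      positivity)
    (c := 0)
    (by
      have h1 := (h.tendsto_energy hp).add
        (((h.tendsto_v.const_sub 1).mul h.tendsto_y).const_mul 2)
      rw [sub_self, zero_mul, mul_zero, add_zero] at h1
      exact h1) ht
  have h1 : v t ^ (p + 1) ≤ v t ^ p := by
    rw [Real.rpow_add_one' (h.nonneg t ht) (by linarith)]
    exact mul_le_of_le_one_right (Real.rpow_nonneg (h.nonneg t ht) _) (h.le_one t ht)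
  have h2 := mul_le_mul_of_nonneg_left h1 (Real.exp_pos (2 * t)).le
  simp only [Pi.add_apply, Pi.mul_apply] at key
  nlinarith

lemma y_zero_ge (h : IsDiskProfile p T v y) (hp : 1 < p) (hT : 0 ≤ T) : 3 / 8 ≤ y 0 := by
  have key := le_of_tendsto_atBot_of_hasDerivAt_nonneg (c := 0) (T := 0)
    (f := fun t => y t - 3 / 8 * Real.exp (2 * t))
    (fun t ht => (h.deriv_y t (ht.trans hT)).sub ((hasDerivAt_exp_two_mul t).const_mul (3 / 8)))
    (fun t ht => by
      have h1 := h.le_v hp (ht.trans hT)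
      have h2 : Real.exp (2 * t) ≤ 1 := Real.exp_le_one_iff.2 (by linarith)
      have h3 : Real.exp (2 * t) / (4 * p) ≤ 1 / (4 * p) := by gcongr
      have h4 : 1 / (4 * p) ≤ 1 / 4 := by
        apply one_div_le_one_div_of_le <;> linarith
      have h5 : 1 + p * (-(1 / (4 * p))) ≤ (1 + -(1 / (4 * p))) ^ p :=
        one_add_mul_self_le_rpow_one_add (by linarith) hp.le
      have h6 : (1 + -(1 / (4 * p))) ^ p ≤ v t ^ p :=
        Real.rpow_le_rpow (by linarith) (by linarith) (by linarith)
      have h7 : 1 + p * (-(1 / (4 * p))) = 3 / 4 := by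
        field_simp; norm_num
      nlinarith [Real.exp_pos (2 * t)])
    (by simpa using h.tendsto_y.sub (tendsto_exp_two_mul_atBot.const_mul (3 / 8))) le_rfl
  simp at key
  linarith

lemma y_ge (h : IsDiskProfile p T v y) {δ S : ℝ} (hδ : 0 < δ) (hp : 1 < p)
    (hpδ : 8 ≤ p * δ) (hS : S = 64 / δ) (hST : S ≤ T) (hv : ∀ t ≤ S, 1 - δ ≤ v t) :
    4 - 5 * δ ≤ y S := by
  by_contra! hc
  have hS0 : 0 ≤ S := by rw [hS]; positivity
  have h0 := h.y_zero_ge hp (hS0.trans hST)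
  have hm := monotoneOn_of_hasDerivAt_nonneg (convex_Icc 0 S)
    (f := fun t => y t - 3 / 32 * δ * t)
    (fun t ht => (h.deriv_y t (ht.2.trans hST)).sub ((hasDerivAt_id t).const_mul (3 / 32 * δ)))
    (fun t ht => by
      have htT := ht.2.trans hST
      have h1 := h.exp_mul_rpow_ge hp htT
      have h2 := h.y_mono (hS0.trans hST) htT ht.1
      have h3 := h.y_mono htT hST ht.2
      have h4 := hv t ht.2
      have h5 : 1 / p ≤ δ / 8 := by
        rw [div_le_div_iff₀ (by linarith) (by norm_num)]; linarith
      have h6 : 1 / p * y t ≤ δ / 8 * 4 := by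
        gcongr
        · exact h.y_nonneg htT
        · exact h.y_le_four hp htT
      have h7 : δ / 4 ≤ 2 * v t - (1 + 1 / p) * y t / 2 := by linarith
      have h8 : 3 / 8 * (δ / 4) ≤ y t * (2 * v t - (1 + 1 / p) * y t / 2) :=
        mul_le_mul (h0.trans h2) h7 (by positivity) (h.y_nonneg htT)
      linarith)
  have h1 := hm ⟨le_rfl, hS0⟩ ⟨hS0, le_rfl⟩ hS0
  have h2 : δ * S = 64 := by rw [hS]; field_simp
  have h3 := h.y_le_four hp hST
  simp only [mul_zero, sub_zero] at h1
  nlinarith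

/-- For large `p` the boundary slope is close to `4` and `T / p` is close to `1 / 4`. -/
lemma bounds (h : IsDiskProfile p T v y) {δ S : ℝ} (hδ : 0 < δ) (hp : 1 < p)
    (hpδ : 8 ≤ p * δ) (hS : S = 64 / δ) (hexp : Real.exp (2 * S) ≤ 4 * p * δ)
    (hδ1 : δ < 1) (hSp : S ≤ p * δ) :
    4 - 5 * δ ≤ y T ∧ y T ≤ 4 ∧ 1 - δ ≤ 4 * (T / p) ∧ (4 - 5 * δ) * (T / p - δ) ≤ 1 := by
  have hp0 : 0 < p := by linarith
  have hST : S ≤ T := by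
    by_contra! hc
    have h1 := h.le_v hp le_rfl
    have h2 : Real.exp (2 * T) ≤ Real.exp (2 * S) := Real.exp_le_exp.2 (by linarith)
    have h3 : Real.exp (2 * T) / (4 * p) ≤ δ := by
      rw [div_le_iff₀ (by positivity)]; linarith
    rw [h.v_end] at h1
    linarith
  have hv : ∀ t ≤ S, 1 - δ ≤ v t := by
    intro t ht
    have h1 := h.le_v hp (ht.trans hST)
    have h2 : Real.exp (2 * t) ≤ Real.exp (2 * S) := Real.exp_le_exp.2 (by linarith)
    have h3 : Real.exp (2 * t) / (4 * p) ≤ δ := by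
      rw [div_le_iff₀ (by positivity)]; linarith
    linarith
  have hy := h.y_ge hδ hp hpδ hS hST hv
  have hS0 : 0 ≤ S := by rw [hS]; positivity
  have hm1 := monotoneOn_of_hasDerivAt_nonneg (convex_Icc S T)
    (f := fun t => p * v t + 4 * t)
    (fun t ht => ((h.deriv_v t ht.2).const_mul p).add ((hasDerivAt_id t).const_mul 4))
    (fun t ht => by
      have h1 := h.y_le_four hp ht.2
      have e : p * -(y t / p) + 4 * 1 = 4 - y t := by field_simp; ring
      rw [e]; linarith)
  have hm2 := monotoneOn_of_hasDerivAt_nonneg (convex_Icc S T)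
    (f := fun t => -(p * v t + (4 - 5 * δ) * t))
    (fun t ht => (((h.deriv_v t ht.2).const_mul p).add
      ((hasDerivAt_id t).const_mul (4 - 5 * δ))).neg)
    (fun t ht => by
      have h1 := h.y_mono hST ht.2 ht.1
      have e : -(p * -(y t / p) + (4 - 5 * δ) * 1) = y t - (4 - 5 * δ) := by field_simp; ring
      rw [e]; linarith)
  have h1 := hm1 ⟨le_rfl, hST⟩ ⟨hST, le_rfl⟩ hST
  have h2 := hm2 ⟨le_rfl, hST⟩ ⟨hST, le_rfl⟩ hST
  simp only [h.v_end] at h1 h2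
  have h3 := hv S le_rfl
  have h4 := h.le_one S hST
  refine ⟨hy.trans (h.y_mono hST (mem_Iic.2 le_rfl) hST), h.y_le_four hp le_rfl, ?_, ?_⟩
  · rw [← mul_div_assoc, le_div_iff₀ hp0]
    nlinarith
  · rcases le_or_gt (4 - 5 * δ) 0 with hneg | hpos
    · have : 0 ≤ T / p - δ ∨ T / p - δ < 0 := le_or_gt _ _
      rcases this with h5 | h5
      · nlinarith
      · have : 0 ≤ T / p := div_nonneg (hS0.trans hST) hp0.le
        nlinarith
    · have h5 : T / p - δ ≤ (T - S) / p := by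
        rw [sub_div]
        have : S / p ≤ δ := by rw [div_le_iff₀ hp0]; linarith
        linarith
      have h6 : (4 - 5 * δ) * ((T - S) / p) ≤ 1 := by
        rw [← mul_div_assoc, div_le_one hp0]
        nlinarith
      nlinarith

end IsDiskProfile

lemma IsDiskProfile.tendsto_seq {p T : ℕ → ℝ} {v y : ℕ → ℝ → ℝ} (hp : ∀ n, 1 < p n)
    (hto : Tendsto p atTop atTop) (h : ∀ n, IsDiskProfile (p n) (T n) (v n) (y n)) :
    Tendsto (fun n => y n (T n)) atTop (nhds 4) ∧
      Tendsto (fun n => T n / p n) atTop (nhds (1 / 4)) := by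
  have key : ∀ η > 0, ∀ᶠ n in atTop, |y n (T n) - 4| < η ∧ |T n / p n - 1 / 4| < η := by
    intro η hη
    obtain ⟨δ, hδ, hδη, hδ1⟩ : ∃ δ : ℝ, 0 < δ ∧ 10 * δ ≤ η ∧ 10 * δ ≤ 1 :=
      ⟨min η 1 / 10, by positivity, by linarith [min_le_left η 1],
        by linarith [min_le_right η 1]⟩
    filter_upwards [hto.eventually_ge_atTop (8 / δ),
      hto.eventually_ge_atTop (Real.exp (2 * (64 / δ)) / (4 * δ)),
      hto.eventually_ge_atTop (64 / δ / δ)] with n h1 h2 h3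
    rw [div_le_iff₀ (by positivity)] at h1 h2 h3
    obtain ⟨h4, h5, h6, h7⟩ :=
      (h n).bounds hδ (hp n) h1 rfl (by linarith) (by linarith) h3
    have h8 : T n / p n - δ ≤ 1 / 4 + δ := by
      by_contra! hc
      nlinarith
    constructor <;> rw [abs_lt] <;> constructor <;> linarith
  constructor
  · rw [Metric.tendsto_nhds]
    intro η hη
    filter_upwards [key η hη] with n hn using hn.1
  · rw [Metric.tendsto_nhds]
    intro η hη
    filter_upwards [key η hη] with n hn using hn.2

lemma mul_one_sub_mul_rpow_le_one {p x : ℝ} (hp : 0 ≤ p) (hx : 0 ≤ x) :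
    p * (1 - x) * x ^ p ≤ 1 := by
  have h1 : x ^ p ≤ Real.exp (-(p * (1 - x))) := by
    calc x ^ p ≤ Real.exp (x - 1) ^ p :=
          Real.rpow_le_rpow hx (by linarith [Real.add_one_le_exp (x - 1)]) hp
      _ = Real.exp (-(p * (1 - x))) := by rw [← Real.exp_mul]; ring_nf
  have h2 : p * (1 - x) ≤ Real.exp (p * (1 - x)) := by
    linarith [Real.add_one_le_exp (p * (1 - x))]
  calc p * (1 - x) * x ^ p ≤ Real.exp (p * (1 - x)) * x ^ p :=
        mul_le_mul_of_nonneg_right h2 (Real.rpow_nonneg hx _)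
    _ ≤ Real.exp (p * (1 - x)) * Real.exp (-(p * (1 - x))) :=
        mul_le_mul_of_nonneg_left h1 (Real.exp_pos _).le
    _ = 1 := by rw [← Real.exp_add]; simp

/-- The slope at the inner boundary of an annular Lane–Emden profile in the logarithmic variable,
between the zero at `A` and the maximum at `B`. -/
lemma annulus_slope_bounds {p A B : ℝ} {v y : ℝ → ℝ} (hp : 1 < p) (hAB : A ≤ B)
    (hv : ∀ t ∈ Icc A B, HasDerivAt v (y t / p) t)
    (hy : ∀ t ∈ Icc A B, HasDerivAt y (-(Real.exp (2 * t) * v t ^ p)) t)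
    (h0 : ∀ t ∈ Icc A B, 0 ≤ v t) (h1 : ∀ t ∈ Icc A B, v t ≤ 1)
    (hA : v A = 0) (hB : v B = 1) (hyB : y B = 0) :
    0 ≤ y A ∧ Real.exp (2 * B) ≤ (1 + 1 / p) * y A ^ 2 / 2 + 2 * y A ∧
      (1 + 1 / p) * y A ^ 2 / 2 + 2 * y A ≤ Real.exp (2 * B) + Real.exp (2 * B) / p := by
  have hp0 : 0 < p := by linarith
  have hmA : A ∈ Icc A B := ⟨le_rfl, hAB⟩
  have hmB : B ∈ Icc A B := ⟨hAB, le_rfl⟩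
  have hE : ∀ t ∈ Icc A B, HasDerivAt
      (fun t => (1 + 1 / p) * y t ^ 2 / 2 + 2 * y t + Real.exp (2 * t) * v t ^ (p + 1))
      (-(2 * (Real.exp (2 * t) * v t ^ p) * (1 - v t))) t := by
    intro t ht
    have h2 := (((((hy t ht).pow 2).const_mul (1 + 1 / p)).div_const 2).add
      ((hy t ht).const_mul 2)).add (hasDerivAt_exp_two_mul_mul_rpow hp (hv t ht))
    refine h2.congr_deriv ?_
    rw [Real.rpow_add_one' (h0 t ht) (by linarith)]
    simp only [Nat.cast_ofNat]
    field_simp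
    ring
  have m0 := monotoneOn_of_hasDerivAt_nonneg (convex_Icc A B)
    (fun t ht => (hy t ht).neg)
    (fun t ht => by
      rw [neg_neg]
      exact mul_nonneg (Real.exp_pos _).le (Real.rpow_nonneg (h0 t ht) _)) hmA hmB hAB
  have m1 := monotoneOn_of_hasDerivAt_nonneg (convex_Icc A B)
    (fun t ht => (hE t ht).neg)
    (fun t ht => by
      have h2 := Real.rpow_nonneg (h0 t ht) p
      have h3 := h1 t ht
      rw [neg_neg]
      exact mul_nonneg (by positivity) (by linarith)) hmA hmB hAB
  have m2 := monotoneOn_of_hasDerivAt_nonneg (convex_Icc A B)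
    (fun t ht => (hE t ht).add ((hasDerivAt_exp_two_mul t).div_const p))
    (fun t ht => by
      have h2 := mul_one_sub_mul_rpow_le_one hp0.le (h0 t ht)
      have e : -(2 * (Real.exp (2 * t) * v t ^ p) * (1 - v t)) + 2 * Real.exp (2 * t) / p
          = 2 * Real.exp (2 * t) / p * (1 - p * (1 - v t) * v t ^ p) := by
        field_simp
        ring
      rw [e]
      exact mul_nonneg (by positivity) (by linarith)) hmA hmB hAB
  have hp1 : p + 1 ≠ 0 := by linarith
  simp only [Pi.neg_apply, Pi.add_apply, hA, hB, hyB, Real.zero_rpow hp1, Real.one_rpow] at m0 m1 m2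
  have h5 : 0 ≤ Real.exp (2 * A) / p := by positivity
  refine ⟨by linarith, by linarith, by linarith⟩

/-- Passing to the limit in `(1 + 1/p) a² / 2 + 2 a → l²` for nonnegative `a` and `p → ∞`. -/
lemma tendsto_of_quadratic {p a : ℕ → ℝ} {l : ℝ} (hp : ∀ n, 1 < p n)
    (hto : Tendsto p atTop atTop) (ha : ∀ n, 0 ≤ a n)
    (hq : Tendsto (fun n => (1 + 1 / p n) * a n ^ 2 / 2 + 2 * a n) atTop (nhds (l ^ 2))) :
    Tendsto a atTop (nhds (alphaOf l - 2)) := by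
  have hpinv : Tendsto (fun n => (p n)⁻¹) atTop (nhds 0) := hto.inv_tendsto_atTop
  have hbd := hq.eventually_le_const (lt_add_one (l ^ 2))
  have hsmall : Tendsto (fun n => 1 / p n * a n ^ 2 / 2) atTop (nhds 0) := by
    refine tendsto_of_tendsto_of_tendsto_of_le_of_le' tendsto_const_nhds
      (by simpa using hpinv.mul_const (l ^ 2 + 1)) ?_ ?_
    · filter_upwards with n
      have := hp n
      positivity
    · filter_upwards [hbd] with n hn
      have h1 := hp n
      have h2 := ha n
      have h3 : 0 ≤ 1 / p n * a n ^ 2 := by positivity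
      have h4 : a n ^ 2 / 2 ≤ l ^ 2 + 1 := by linarith
      have h5 : 0 ≤ (p n)⁻¹ := by positivity
      calc 1 / p n * a n ^ 2 / 2 = (p n)⁻¹ * (a n ^ 2 / 2) := by ring
        _ ≤ (p n)⁻¹ * (l ^ 2 + 1) := by gcongr
  have hsq : Tendsto (fun n => (a n + 2) ^ 2) atTop (nhds (2 * l ^ 2 + 4)) := by
    have h1 := ((hq.sub hsmall).const_mul 2).add_const 4
    rw [sub_zero] at h1
    refine h1.congr fun n => ?_
    ring
  have h2 := (hsq.sqrt).sub_const 2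
  refine h2.congr fun n => ?_
  rw [Real.sqrt_sq (by linarith [ha n])]
  ring

namespace LaneEmdenFamily

variable (F : LaneEmdenFamily) {p : ℝ}

lemma hasDerivAt_u (hp : 1 < p) {r : ℝ} (hr : r ∈ Ioo (0 : ℝ) 1) :
    HasDerivAt (F.u p) (deriv (F.u p) r) r :=
  (((F.smooth p hp).contDiffAt (Icc_mem_nhds hr.1 hr.2)).differentiableAt
    two_ne_zero).hasDerivAt

lemma hasDerivAt_deriv_u (hp : 1 < p) {r : ℝ} (hr : r ∈ Ioo (0 : ℝ) 1) :
    HasDerivAt (deriv (F.u p)) (deriv (deriv (F.u p)) r) r := by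
  have h1 : ContDiffOn ℝ 2 (F.u p) (Ioo 0 1) := (F.smooth p hp).mono Ioo_subset_Icc_self
  have h2 : ContDiffOn ℝ 1 (deriv (F.u p)) (Ioo 0 1) :=
    h1.deriv_of_isOpen isOpen_Ioo (by norm_num)
  exact ((h2.contDiffAt (isOpen_Ioo.mem_nhds hr)).differentiableAt one_ne_zero).hasDerivAt

lemma hasDerivAt_rescaled (hp : 1 < p) {ε c t : ℝ} (hε : 0 < ε)
    (ht : ε * Real.exp t < 1) :
    HasDerivAt (fun t => F.u p (ε * Real.exp t) / c)
      (p * (ε * Real.exp t * deriv (F.u p) (ε * Real.exp t)) / c / p) t := by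
  have hr : ε * Real.exp t ∈ Ioo (0 : ℝ) 1 := ⟨by positivity, ht⟩
  have h := ((F.hasDerivAt_u hp hr).comp t ((Real.hasDerivAt_exp t).const_mul ε)).div_const c
  refine h.congr_deriv ?_
  have : p ≠ 0 := by linarith
  field_simp

lemma hasDerivAt_rescaled_slope (hp : 1 < p) {ε c t : ℝ} (hε : 0 < ε) (hc : c ≠ 0)
    (hεc : p * ε ^ 2 * |c| ^ (p - 1) = 1) (ht : ε * Real.exp t < 1)
    (hnn : 0 ≤ F.u p (ε * Real.exp t) / c) :
    HasDerivAt (fun t => p * (ε * Real.exp t * deriv (F.u p) (ε * Real.exp t)) / c)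
      (-(Real.exp (2 * t) * (F.u p (ε * Real.exp t) / c) ^ p)) t := by
  have hr : ε * Real.exp t ∈ Ioo (0 : ℝ) 1 := ⟨by positivity, ht⟩
  have hE := (Real.hasDerivAt_exp t).const_mul ε
  have h := ((hE.mul ((F.hasDerivAt_deriv_u hp hr).comp t hE)).const_mul p).div_const c
  refine h.congr_deriv ?_
  have hode := F.ode p hp _ hr
  simp only [Function.comp_apply]
  set r := ε * Real.exp t with hrdef
  set w := F.u p r with hw
  have hr0 : r ≠ 0 := hr.1.ne'
  have h1 : (w / c) ^ p = |w| ^ (p - 1) / |c| ^ (p - 1) * (w / c) := by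
    have : p = (p - 1) + 1 := by ring
    rw [this, Real.rpow_add_one' hnn (by linarith), ← Real.div_rpow (abs_nonneg _) (abs_nonneg _),
      ← abs_div, abs_of_nonneg hnn]
    simp
  have h2 : Real.exp (2 * t) = r ^ 2 / ε ^ 2 := by
    rw [hrdef, two_mul, Real.exp_add]
    field_simp
  have h3 : r * deriv (F.u p) r + r * (deriv (deriv (F.u p)) r * r)
      = -(r ^ 2 * (|w| ^ (p - 1) * w)) := by
    rw [← hode]
    field_simp
    ring
  have hcp : |c| ^ (p - 1) ≠ 0 := by
    have := abs_pos.2 hc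
    positivity
  rw [h3, h1, h2]
  have h4 : p = 1 / (ε ^ 2 * |c| ^ (p - 1)) := by
    field_simp
    linarith
  generalize |c| ^ (p - 1) = K at *
  generalize |w| ^ (p - 1) = W at *
  have h5 : p * -(r ^ 2 * (W * w)) / c = -(r ^ 2 * (W * w)) / c * (p * ε ^ 2 * K) / (ε ^ 2 * K) := by
    field_simp
  rw [h5, hεc]
  field_simp

lemma mul_sq_mul_rpow_eq_one (hp : 1 < p) {M : ℝ} (hM : 0 < M) :
    p * (1 / Real.sqrt (p * M ^ (p - 1))) ^ 2 * M ^ (p - 1) = 1 := by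
  have : 0 < p := by linarith
  have h := Real.rpow_pos_of_pos hM (p - 1)
  rw [div_pow, Real.sq_sqrt (by positivity)]
  field_simp

lemma u_sp_pos (hp : 1 < p) : 0 < F.u p (F.sp p) := F.pos_out p hp _ (F.sp_mem p hp)

lemma epsP_pos (hp : 1 < p) : 0 < epsP F p := by
  have := F.u_sp_pos hp
  unfold epsP
  positivity

lemma epsM_pos (hp : 1 < p) : 0 < epsM F p := by
  have : 0 < -F.u p 0 := neg_pos.2 (F.center_neg p hp)
  unfold epsM
  positivity

lemma deriv_u_sp (hp : 1 < p) : deriv (F.u p) (F.sp p) = 0 := by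
  have h1 := F.sp_mem p hp
  have h2 := F.rp_mem p hp
  refine IsLocalMax.deriv_eq_zero ?_
  filter_upwards [Icc_mem_nhds (h2.1.trans h1.1) h1.2] with r hr using F.sp_max p hp r hr

lemma outer_slope_bounds (hp : 1 < p) :
    0 ≤ p * (F.rp p * deriv (F.u p) (F.rp p)) / F.u p (F.sp p) ∧
    (F.sp p / epsP F p) ^ 2 ≤
      (1 + 1 / p) * (p * (F.rp p * deriv (F.u p) (F.rp p)) / F.u p (F.sp p)) ^ 2 / 2
        + 2 * (p * (F.rp p * deriv (F.u p) (F.rp p)) / F.u p (F.sp p)) ∧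
    (1 + 1 / p) * (p * (F.rp p * deriv (F.u p) (F.rp p)) / F.u p (F.sp p)) ^ 2 / 2
        + 2 * (p * (F.rp p * deriv (F.u p) (F.rp p)) / F.u p (F.sp p))
      ≤ (F.sp p / epsP F p) ^ 2 + (F.sp p / epsP F p) ^ 2 / p := by
  have hM := F.u_sp_pos hp
  have hε := F.epsP_pos hp
  obtain ⟨hr0, hr1⟩ := F.rp_mem p hp
  obtain ⟨hs0, hs1⟩ := F.sp_mem p hp
  have hεM : p * epsP F p ^ 2 * |F.u p (F.sp p)| ^ (p - 1) = 1 := by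
    rw [abs_of_pos hM]
    exact mul_sq_mul_rpow_eq_one hp hM
  set ε := epsP F p
  have hsp : 0 < F.sp p := hr0.trans hs0
  have eA : ε * Real.exp (Real.log (F.rp p / ε)) = F.rp p := by
    rw [Real.exp_log (by positivity)]; field_simp
  have eB : ε * Real.exp (Real.log (F.sp p / ε)) = F.sp p := by
    rw [Real.exp_log (by positivity)]; field_simp
  have hmem : ∀ t ∈ Icc (Real.log (F.rp p / ε)) (Real.log (F.sp p / ε)),
      F.rp p ≤ ε * Real.exp t ∧ ε * Real.exp t ≤ F.sp p := by
    intro t ht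
    constructor
    · rw [← eA]; gcongr; exact ht.1
    · rw [← eB]; gcongr; exact ht.2
  have hnn : ∀ t ∈ Icc (Real.log (F.rp p / ε)) (Real.log (F.sp p / ε)),
      0 ≤ F.u p (ε * Real.exp t) / F.u p (F.sp p) := by
    intro t ht
    obtain ⟨h1, h2⟩ := hmem t ht
    refine div_nonneg ?_ hM.le
    rcases h1.eq_or_lt with h1 | h1
    · rw [← h1, F.rp_zero p hp]
    · exact (F.pos_out p hp _ ⟨h1, h2.trans_lt hs1⟩).le
  have key := annulus_slope_bounds hp
    (v := fun t => F.u p (ε * Real.exp t) / F.u p (F.sp p))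
    (y := fun t => p * (ε * Real.exp t * deriv (F.u p) (ε * Real.exp t)) / F.u p (F.sp p))
    (A := Real.log (F.rp p / ε)) (B := Real.log (F.sp p / ε))
    (Real.log_le_log (by positivity) (by gcongr))
    (fun t ht => F.hasDerivAt_rescaled hp hε ((hmem t ht).2.trans_lt hs1))
    (fun t ht => F.hasDerivAt_rescaled_slope hp hε hM.ne' hεM ((hmem t ht).2.trans_lt hs1)
      (hnn t ht))
    hnn
    (fun t ht => by
      obtain ⟨h1, h2⟩ := hmem t ht
      rw [div_le_one hM]
      exact F.sp_max p hp _ ⟨hr0.le.trans h1, (h2.trans_lt hs1).le⟩)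
    (by simp only [eA, F.rp_zero p hp, zero_div])
    (by simp only [eB, div_self hM.ne'])
    (by simp only [eB, F.deriv_u_sp hp, mul_zero, zero_div])
  have e2 : Real.exp (2 * Real.log (F.sp p / ε)) = (F.sp p / ε) ^ 2 := by
    rw [two_mul, Real.exp_add, Real.exp_log (by positivity), sq]
  simpa only [eA, e2] using key

lemma isDiskProfile (hp : 1 < p) :
    IsDiskProfile p (Real.log (F.rp p / epsM F p))
      (fun t => F.u p (epsM F p * Real.exp t) / F.u p 0)
      (fun t => -(p * (epsM F p * Real.exp t * deriv (F.u p) (epsM F p * Real.exp t))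
        / F.u p 0)) := by
  have hc := F.center_neg p hp
  have hm : 0 < -F.u p 0 := neg_pos.2 hc
  have hε := F.epsM_pos hp
  obtain ⟨hr0, hr1⟩ := F.rp_mem p hp
  have hεm : p * epsM F p ^ 2 * |F.u p 0| ^ (p - 1) = 1 := by
    rw [abs_of_neg hc]
    exact mul_sq_mul_rpow_eq_one hp hm
  set ε := epsM F p
  have eT : ε * Real.exp (Real.log (F.rp p / ε)) = F.rp p := by
    rw [Real.exp_log (by positivity)]; field_simp
  have hle : ∀ t ≤ Real.log (F.rp p / ε), ε * Real.exp t ≤ F.rp p := by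
    intro t ht
    rw [← eT]; gcongr
  have hlt : ∀ t ≤ Real.log (F.rp p / ε), ε * Real.exp t < 1 := fun t ht =>
    (hle t ht).trans_lt hr1
  have hnn : ∀ t ≤ Real.log (F.rp p / ε), 0 ≤ F.u p (ε * Real.exp t) / F.u p 0 := by
    intro t ht
    refine div_nonneg_of_nonpos ?_ hc.le
    rcases (hle t ht).eq_or_lt with h1 | h1
    · rw [h1, F.rp_zero p hp]
    · exact (F.neg_in p hp _ ⟨by positivity, h1⟩).le
  have hlim : Tendsto (fun t => ε * Real.exp t) atBot (nhds 0) := by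
    simpa using Real.tendsto_exp_atBot.const_mul ε
  have hlimIcc : Tendsto (fun t => ε * Real.exp t) atBot (nhdsWithin 0 (Icc 0 1)) := by
    refine tendsto_nhdsWithin_iff.2 ⟨hlim, ?_⟩
    filter_upwards [eventually_le_atBot (Real.log (F.rp p / ε))] with t ht
    exact ⟨by positivity, (hlt t ht).le⟩
  have hmem0 : (0 : ℝ) ∈ Icc (0 : ℝ) 1 := ⟨le_rfl, zero_le_one⟩
  refine ⟨fun t ht => ?_, fun t ht => ?_, hnn, fun t ht => ?_, ?_, ?_, ?_⟩
  · refine (F.hasDerivAt_rescaled hp hε (hlt t ht)).congr_deriv ?_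
    ring
  · refine (F.hasDerivAt_rescaled_slope hp hε hc.ne hεm (hlt t ht) (hnn t ht)).neg.congr_deriv ?_
    ring
  · rw [div_le_one_of_neg hc]
    exact F.min_at_zero p hp _ ⟨by positivity, (hlt t ht).le⟩
  · have h1 := ((F.smooth p hp).continuousOn 0 hmem0).tendsto.comp hlimIcc
    simpa [div_self hc.ne] using h1.div_const (F.u p 0)
  · have h1 : ContinuousOn (derivWithin (F.u p) (Icc 0 1)) (Icc 0 1) :=
      (F.smooth p hp).continuousOn_derivWithin (uniqueDiffOn_Icc zero_lt_one) (by norm_num)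
    have h2 := (h1 0 hmem0).tendsto.comp hlimIcc
    have h3 := (((hlim.mul h2).const_mul p).div_const (F.u p 0)).neg
    simp only [zero_mul, mul_zero, zero_div, neg_zero] at h3
    refine h3.congr' ?_
    filter_upwards [eventually_le_atBot (Real.log (F.rp p / ε))] with t ht
    simp only [Function.comp_apply]
    rw [derivWithin_of_mem_nhds (Icc_mem_nhds (by positivity) (hlt t ht))]
  · simp only [eT, F.rp_zero p hp, zero_div]

lemma log_center (hp : 1 < p) :
    Real.log (-F.u p 0) = 2 * (Real.log (F.rp p / epsM F p) / p) * (1 + 1 / (p - 1))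
      - Real.log (F.rp p ^ (2 / (p - 1))) - Real.log p / (p - 1) := by
  have hm : 0 < -F.u p 0 := neg_pos.2 (F.center_neg p hp)
  obtain ⟨hr0, hr1⟩ := F.rp_mem p hp
  have hp0 : 0 < p := by linarith
  have hp1 : p - 1 ≠ 0 := by linarith
  rw [Real.log_rpow hr0, Real.log_div hr0.ne' (F.epsM_pos hp).ne', epsM, one_div, Real.log_inv,
    Real.log_sqrt (by positivity), Real.log_mul hp0.ne' (by positivity), Real.log_rpow hm]
  field_simp
  ring

end LaneEmdenFamily

lemma tendsto_log_div_sub_one_atTop :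
    Tendsto (fun x : ℝ => Real.log x / (x - 1)) atTop (nhds 0) := by
  simpa [sub_eq_add_neg] using Real.tendsto_pow_log_div_mul_add_atTop 1 (-1) 1 one_ne_zero

/-- Under the stated limit assumptions (with `α = √(2l²+4)`), one has `4√e/r_∞ = u_∞·(α − 2)`. -/
theorem four_sqrt_e_identity (F : LaneEmdenFamily) (pn : ℕ → ℝ) (hpn : ∀ n, 1 < pn n)
    (hto : Tendsto pn atTop atTop) (l rinf uinf : ℝ)
    (hl : 0 < l) (hrinf : 0 < rinf) (hrinf1 : rinf ≤ 1) (huinf : 0 < uinf)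
    (hlimL : Tendsto (fun n => F.sp (pn n) / epsP F (pn n)) atTop (nhds l))
    (hlimR : Tendsto (fun n => F.rp (pn n) ^ (2 / (pn n - 1))) atTop (nhds rinf))
    (hlimU : Tendsto (fun n => F.u (pn n) (F.sp (pn n))) atTop (nhds uinf)) :
    4 * Real.sqrt (Real.exp 1) / rinf = uinf * (alphaOf l - 2) := by
  have hslope := IsDiskProfile.tendsto_seq hpn hto fun n => F.isDiskProfile (hpn n)
  have hcenter : Tendsto (fun n => -F.u (pn n) 0) atTop
      (nhds (Real.sqrt (Real.exp 1) / rinf)) := by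
    have h1 : Tendsto (fun n => 1 / (pn n - 1)) atTop (nhds 0) := by
      simp only [one_div]
      exact (tendsto_atTop_add_const_right _ (-1) hto).inv_tendsto_atTop
    have h2 := (((hslope.2.const_mul 2).mul (h1.const_add 1)).sub (hlimR.log hrinf.ne')).sub
      (tendsto_log_div_sub_one_atTop.comp hto)
    have h3 := h2.rexp
    have e : Real.exp (2 * (1 / 4) * (1 + 0) - Real.log rinf - 0)
        = Real.sqrt (Real.exp 1) / rinf := by
      rw [sub_zero, Real.exp_sub, Real.exp_log hrinf, ← Real.exp_half]
      norm_num
    rw [e] at h3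
    refine h3.congr fun n => ?_
    simp only [Function.comp_apply]
    rw [← F.log_center (hpn n), Real.exp_log (neg_pos.2 (F.center_neg _ (hpn n)))]
  have hq : Tendsto (fun n => (1 + 1 / pn n) * (pn n * (F.rp (pn n) *
      deriv (F.u (pn n)) (F.rp (pn n))) / F.u (pn n) (F.sp (pn n))) ^ 2 / 2
        + 2 * (pn n * (F.rp (pn n) * deriv (F.u (pn n)) (F.rp (pn n)))
          / F.u (pn n) (F.sp (pn n)))) atTop (nhds (l ^ 2)) :=
    tendsto_of_tendsto_of_tendsto_of_le_of_le (hlimL.pow 2)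
      (by simpa using (hlimL.pow 2).add ((hlimL.pow 2).div_atTop hto))
      (fun n => (F.outer_slope_bounds (hpn n)).2.1)
      (fun n => (F.outer_slope_bounds (hpn n)).2.2)
  have houter := (tendsto_of_quadratic hpn hto
    (fun n => (F.outer_slope_bounds (hpn n)).1) hq).mul hlimU
  have hinner := hslope.1.mul hcenter
  have huniq := tendsto_nhds_unique (houter.congr fun n => ?_) hinner
  · rw [mul_div_assoc, ← huniq, mul_comm]
  · have hM := F.u_sp_pos (hpn n)
    have hε := F.epsM_pos (hpn n)
    have hr := (F.rp_mem _ (hpn n)).1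
    have hc := (F.center_neg _ (hpn n)).ne
    rw [Real.exp_log (by positivity), mul_div_cancel₀ _ hε.ne']
    field_simp
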